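/- Let X be a real n×m matrix with n > m and rank(X) = m. Then X is m-sign consistent if and only if X is (m−1)-variation bounding. -/

import Mathlib

open Matrix Polynomial Filter

noncomputable def signChanges (l : List ℝ) : ℕ :=
  (l.zip l.tail).countP (fun p => decide (p.1 * p.2 < 0))

/-- Variation `V(u)`: number of sign changes after deleting zero entries, `-1` for the
zero vector. -/
noncomputable def variation {m : ℕ} (u : Fin m → ℝ) : ℤ :=
  if ((List.ofFn u).filter fun x => decide (x ≠ 0)) = [] then -1
  else (signChanges ((List.ofFn u).filter fun x => decide (x ≠ 0)) : ℤ)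

/-- Maximal variation `V_z(u)`: largest number of sign changes obtainable by replacing every
zero entry of `u` by an arbitrary nonzero real number. -/
noncomputable def maxVariation {m : ℕ} (u : Fin m → ℝ) : ℤ :=
  sSup {v : ℤ | ∃ w : Fin m → ℝ, (∀ i, w i ≠ 0) ∧ (∀ i, u i ≠ 0 → w i = u i) ∧
    v = (signChanges (List.ofFn w) : ℤ)}

/-- `X` is strictly `k`-variation bounding. -/
def SVB {n m : ℕ} (X : Matrix (Fin n) (Fin m) ℝ) (k : ℕ) : Prop :=
  ∀ u : Fin m → ℝ, u ≠ 0 → variation u ≤ (k : ℤ) → maxVariation (X.mulVec u) ≤ (k : ℤ)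

/-- `X` is `k`-variation bounding. -/
def VB {n m : ℕ} (X : Matrix (Fin n) (Fin m) ℝ) (k : ℕ) : Prop :=
  ∀ u : Fin m → ℝ, u ≠ 0 → variation u ≤ (k : ℤ) → variation (X.mulVec u) ≤ (k : ℤ)

/-- `X` is `k`-variation diminishing. -/
def VD {n m : ℕ} (X : Matrix (Fin n) (Fin m) ℝ) (k : ℕ) : Prop :=
  ∀ j : ℕ, j ≤ k → VB X j

/-- `X` is strictly `k`-sign consistent: all `k×k` minors strictly positive, or all strictly
negative. -/
def SSC {n m : ℕ} (X : Matrix (Fin n) (Fin m) ℝ) (k : ℕ) : Prop :=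
  (∀ (f : Fin k → Fin n) (g : Fin k → Fin m), StrictMono f → StrictMono g →
    0 < (X.submatrix f g).det) ∨
  (∀ (f : Fin k → Fin n) (g : Fin k → Fin m), StrictMono f → StrictMono g →
    (X.submatrix f g).det < 0)

/-- `X` is `k`-sign consistent: all `k×k` minors nonnegative, or all nonpositive. -/
def SC {n m : ℕ} (X : Matrix (Fin n) (Fin m) ℝ) (k : ℕ) : Prop :=
  (∀ (f : Fin k → Fin n) (g : Fin k → Fin m), StrictMono f → StrictMono g →
    0 ≤ (X.submatrix f g).det) ∨
  (∀ (f : Fin k → Fin n) (g : Fin k → Fin m), StrictMono f → StrictMono g →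
    (X.submatrix f g).det ≤ 0)

/-- `X` is `k`-sign regular. -/
def SR {n m : ℕ} (X : Matrix (Fin n) (Fin m) ℝ) (k : ℕ) : Prop :=
  ∀ j : ℕ, 1 ≤ j → j ≤ k → SC X j

/-- `X` is strictly totally positive. -/
def STP {n m : ℕ} (X : Matrix (Fin n) (Fin m) ℝ) : Prop :=
  ∀ (j : ℕ) (f : Fin j → Fin n) (g : Fin j → Fin m), StrictMono f → StrictMono g →
    0 < (X.submatrix f g).det

/-- `X` is `k`-positive: all `j×j` minors nonnegative for `j = 1, …, k`. -/
def KPos {n m : ℕ} (X : Matrix (Fin n) (Fin m) ℝ) (k : ℕ) : Prop :=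
  ∀ j : ℕ, 1 ≤ j → j ≤ k → ∀ (f : Fin j → Fin n) (g : Fin j → Fin m),
    StrictMono f → StrictMono g → 0 ≤ (X.submatrix f g).det

/-- `X` is strictly `k`-positive: all `j×j` minors positive for `j = 1, …, k`. -/
def KPosStrict {n m : ℕ} (X : Matrix (Fin n) (Fin m) ℝ) (k : ℕ) : Prop :=
  ∀ j : ℕ, 1 ≤ j → j ≤ k → ∀ (f : Fin j → Fin n) (g : Fin j → Fin m),
    StrictMono f → StrictMono g → 0 < (X.submatrix f g).det

/-- The `t`-step observability matrix `O_t` with `i`-th row `c Aⁱ⁻¹`. -/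
noncomputable def obsMat {n : ℕ} (A : Matrix (Fin n) (Fin n) ℝ) (c : Fin n → ℝ) (t : ℕ) :
    Matrix (Fin t) (Fin n) ℝ :=
  Matrix.of fun i j => Matrix.vecMul c (A ^ (i : ℕ)) j

/-- The pair `(A, c)` is observable. -/
def Observable {n : ℕ} (A : Matrix (Fin n) (Fin n) ℝ) (c : Fin n → ℝ) : Prop :=
  (obsMat A c n).det ≠ 0

/-- The observability operator of `(A, c)` is strictly `k`-variation bounding. -/
def ObsSVB {n : ℕ} (A : Matrix (Fin n) (Fin n) ℝ) (c : Fin n → ℝ) (k : ℕ) : Prop :=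
  ∀ t : ℕ, 0 < t → SVB (obsMat A c t) k

/-- The observability operator of `(A, c)` is `k`-variation bounding. -/
def ObsVB {n : ℕ} (A : Matrix (Fin n) (Fin n) ℝ) (c : Fin n → ℝ) (k : ℕ) : Prop :=
  ∀ t : ℕ, 0 < t → VB (obsMat A c t) k

/-- The matrix `M_r[t]`: first `n - r` rows `c, cA, …, cA^{n-r-1}`, last `r` rows
`cA^{n-r+t-1}, …, cA^{n+t-2}`. -/
noncomputable def Mrt {n : ℕ} (A : Matrix (Fin n) (Fin n) ℝ) (c : Fin n → ℝ) (r t : ℕ) :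
    Matrix (Fin n) (Fin n) ℝ :=
  Matrix.of fun i j =>
    Matrix.vecMul c (A ^ (if (i : ℕ) < n - r then (i : ℕ) else (i : ℕ) + t - 1)) j

/-! ### Sign changes of lists -/

lemma signChanges_cons_cons (a b : ℝ) (l : List ℝ) :
    signChanges (a :: b :: l) = signChanges (b :: l) + if a * b < 0 then 1 else 0 := by
  simp [signChanges, List.countP_cons]

lemma signChanges_le_length_sub_one (l : List ℝ) : signChanges l ≤ l.length - 1 := by
  refine List.countP_le_length.trans ?_
  simp

lemma exists_isChain_sublist_of_signChanges (t : List ℝ) :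
    ∀ a : ℝ, (∀ x ∈ a :: t, x ≠ 0) →
      ∃ t', t'.Sublist t ∧ (a :: t').IsChain (fun x y => x * y < 0) ∧
        t'.length = signChanges (a :: t) := by
  induction t with
  | nil => exact fun a _ => ⟨[], by simp [signChanges]⟩
  | cons b t ih =>
    intro a h
    obtain ⟨t', hs, hc, hl⟩ := ih b (fun x hx => h x (List.mem_cons_of_mem _ hx))
    rw [signChanges_cons_cons]
    by_cases hab : a * b < 0
    · exact ⟨b :: t', hs.cons_cons b, List.isChain_cons_cons.2 ⟨hab, hc⟩, by simp [hl, hab]⟩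
    · refine ⟨t', hs.cons b, ?_, by simp [hl, hab]⟩
      have ha : a ≠ 0 := h a (by simp)
      have hb : b ≠ 0 := h b (by simp)
      have hpos : 0 < a * b := lt_of_le_of_ne (not_lt.1 hab) (mul_ne_zero ha hb).symm
      cases t' with
      | nil => simp
      | cons c t' =>
        rw [List.isChain_cons_cons] at hc ⊢
        refine ⟨?_, hc.2⟩
        have h1 : (a * b) * (b * c) < 0 := mul_neg_of_pos_of_neg hpos hc.1
        have h2 : 0 < b ^ 2 := by positivity
        by_contra h3
        nlinarith [mul_nonneg h2.le (not_lt.1 h3)]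

lemma signChanges_cons_le_insert {a b : ℝ} (hb : b ≠ 0) (l : List ℝ) :
    signChanges (a :: l) ≤ signChanges (a :: b :: l) := by
  cases l with
  | nil => simp [signChanges]
  | cons c l =>
    simp only [signChanges_cons_cons]
    have : a * c < 0 → a * b < 0 ∨ b * c < 0 := by
      intro h
      by_contra! h'
      have h2 : 0 < b ^ 2 := by positivity
      nlinarith [mul_nonneg h'.1 h'.2]
    split_ifs <;> first | omega | tauto

lemma signChanges_cons_le_of_sublist {l' l : List ℝ} (h : l'.Sublist l) :
    (∀ x ∈ l, x ≠ 0) → ∀ a, signChanges (a :: l') ≤ signChanges (a :: l) := by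
  induction h with
  | slnil => simp
  | @cons l₁ l₂ b _ ih =>
    intro hl a
    exact (ih (fun x hx => hl x (List.mem_cons_of_mem _ hx)) a).trans
      (signChanges_cons_le_insert (hl b (by simp)) _)
  | @cons_cons l₁ l₂ b _ ih =>
    intro hl a
    simp only [signChanges_cons_cons]
    exact Nat.add_le_add_right (ih (fun x hx => hl x (List.mem_cons_of_mem _ hx)) b) _

lemma signChanges_le_of_sublist {l' l : List ℝ} (h : l'.Sublist l) (hl : ∀ x ∈ l, x ≠ 0) :
    signChanges l' ≤ signChanges l := by
  have h0 : ∀ k : List ℝ, signChanges ((0 : ℝ) :: k) = signChanges k := by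
    intro k
    cases k with
    | nil => simp [signChanges]
    | cons c k => simp [signChanges_cons_cons]
  simpa [h0] using signChanges_cons_le_of_sublist h hl 0

lemma signChanges_of_isChain (l : List ℝ) (h : l.IsChain (fun x y => x * y < 0)) :
    signChanges l = l.length - 1 := by
  induction l with
  | nil => simp [signChanges]
  | cons a l ih =>
    cases l with
    | nil => simp [signChanges]
    | cons b l =>
      rw [List.isChain_cons_cons] at h
      rw [signChanges_cons_cons, ih h.2]
      simp [h.1]

/-! ### Variation and alternating subsequences -/

lemma variation_le_pred {m : ℕ} (u : Fin m → ℝ) : variation u ≤ ((m - 1 : ℕ) : ℤ) := by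
  unfold variation
  split_ifs
  · omega
  · have h1 := signChanges_le_length_sub_one ((List.ofFn u).filter fun x => decide (x ≠ 0))
    have h2 := List.length_filter_le (fun x => decide (x ≠ 0)) (List.ofFn u)
    rw [List.length_ofFn] at h2
    exact_mod_cast h1.trans (Nat.sub_le_sub_right h2 1)

lemma le_variation_of_alternating {n k : ℕ} {v : Fin n → ℝ} {f : Fin (k + 1) → Fin n}
    (hf : StrictMono f) (h : ∀ i : Fin (k + 1), 0 < (-1 : ℝ) ^ (i : ℕ) * v (f i)) :
    (k : ℤ) ≤ variation v := by
  have hne : ∀ i, v (f i) ≠ 0 := fun i h0 => by simpa [h0] using h i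
  have hsub : (List.ofFn (v ∘ f)).Sublist (List.ofFn v) := by
    rw [List.sublist_iff_exists_fin_orderEmbedding_get_eq]
    refine ⟨OrderEmbedding.ofStrictMono
      (fun i => Fin.cast (by simp) (f (Fin.cast (by simp) i))) ?_, ?_⟩
    · intro i j hij
      exact hf hij
    · intro i
      simp only [List.get_eq_getElem, List.getElem_ofFn]
      rfl
  have hsub' := hsub.filter (fun x => decide (x ≠ 0))
  have hself : (List.ofFn (v ∘ f)).filter (fun x => decide (x ≠ 0)) = List.ofFn (v ∘ f) := by
    rw [List.filter_eq_self]
    intro x hx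
    obtain ⟨i, rfl⟩ := (List.mem_ofFn' _ _).1 hx
    simpa using hne i
  rw [hself] at hsub'
  have hchain : (List.ofFn (v ∘ f)).IsChain (fun x y => x * y < 0) := by
    rw [List.isChain_iff_getElem]
    intro i hi
    simp only [List.length_ofFn] at hi
    simp only [List.getElem_ofFn, Function.comp]
    have h1 := h ⟨i, by omega⟩
    have h2 := h ⟨i + 1, by omega⟩
    have h3 := mul_pos h1 h2
    have h4 : ((-1 : ℝ) ^ i) ^ 2 = 1 := by rw [← pow_mul, mul_comm, pow_mul]; simp
    simp only [pow_succ] at h3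
    nlinarith
  have hsc := signChanges_le_of_sublist hsub' (by simp)
  rw [signChanges_of_isChain _ hchain, List.length_ofFn] at hsc
  unfold variation
  split_ifs with hnil
  · rw [hnil] at hsub'
    simp at hsub'
  · exact_mod_cast hsc

lemma exists_alternating_of_le_variation {n k : ℕ} {v : Fin n → ℝ}
    (h : (k : ℤ) ≤ variation v) :
    ∃ f : Fin (k + 1) → Fin n, StrictMono f ∧ ∃ σ : ℝ,
      ∀ i : Fin (k + 1), 0 < (-1 : ℝ) ^ (i : ℕ) * (σ * v (f i)) := by
  unfold variation at h
  split_ifs at h with hnil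
  · omega
  have hk : k ≤ signChanges ((List.ofFn v).filter fun x => decide (x ≠ 0)) := by exact_mod_cast h
  obtain ⟨a, t, hat⟩ := List.exists_cons_of_ne_nil hnil
  have hmem : ∀ x ∈ a :: t, x ≠ 0 := by
    rw [← hat]
    simp
  rw [hat] at hk
  obtain ⟨t', hs, hc, hl⟩ := exists_isChain_sublist_of_signChanges t a hmem
  have hsub : (a :: t').Sublist (List.ofFn v) := by
    refine (hs.cons_cons a).trans ?_
    rw [← hat]
    exact List.filter_sublist
  have ha : a ≠ 0 := hmem a (by simp)
  rw [List.sublist_iff_exists_fin_orderEmbedding_get_eq] at hsub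
  obtain ⟨e, he⟩ := hsub
  have hlen : k + 1 ≤ (a :: t').length := by simp; omega
  have hv : ∀ i : Fin (k + 1), v (Fin.cast (by simp) (e (Fin.castLE hlen i))) =
      (a :: t')[(i : ℕ)]'(lt_of_lt_of_le i.2 hlen) := by
    intro i
    have := he (Fin.castLE hlen i)
    simp only [List.get_eq_getElem, List.getElem_ofFn] at this
    exact this.symm
  refine ⟨fun i => Fin.cast (by simp) (e (Fin.castLE hlen i)), ?_, a, ?_⟩
  · intro i j hij
    exact e.strictMono hij
  · intro i
    rw [hv i]
    obtain ⟨i, hi⟩ := i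
    simp only
    induction i with
    | zero => simpa using mul_self_pos.2 ha
    | succ i ih =>
      have h1 := ih (by omega)
      have h2 := List.isChain_iff_getElem.1 hc i (by omega)
      rw [pow_succ]
      set p := (a :: t')[i]'(by omega)
      set q := (a :: t')[i + 1]'(by omega)
      have hp : 0 < p ^ 2 := by
        have : p ≠ 0 := fun h0 => by simp [h0] at h1
        positivity
      by_contra h3
      have h4 : 0 ≤ (-1 : ℝ) ^ i * (a * q) := by linarith
      nlinarith [mul_nonneg hp.le h4, mul_neg_of_pos_of_neg h1 h2]

/-! ### Maximal minors and the column space -/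

section Minors

variable {n m : ℕ}

lemma det_cons_submatrix (X : Matrix (Fin n) (Fin m) ℝ) (F : Fin (m + 1) → Fin n)
    (y : Fin (m + 1) → ℝ) :
    (Matrix.of fun i => (Fin.cons (y i) (fun j => X (F i) j) : Fin (m + 1) → ℝ)).det =
      ∑ i : Fin (m + 1), (-1 : ℝ) ^ (i : ℕ) * y i * (X.submatrix (F ∘ i.succAbove) id).det := by
  rw [det_succ_column_zero]
  refine Finset.sum_congr rfl fun i _ => ?_
  congr 2

lemma exists_of_sum_minors_eq_zero (X : Matrix (Fin n) (Fin m) ℝ) (F : Fin (m + 1) → Fin n)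
    (y : Fin (m + 1) → ℝ)
    (h : ∑ i : Fin (m + 1), (-1 : ℝ) ^ (i : ℕ) * y i * (X.submatrix (F ∘ i.succAbove) id).det = 0) :
    (∃ u ≠ 0, ∀ i, (X *ᵥ u) (F i) = 0) ∨ ∃ u, ∀ i, (X *ᵥ u) (F i) = y i := by
  rw [← det_cons_submatrix, ← exists_mulVec_eq_zero_iff] at h
  obtain ⟨z, hz, hzero⟩ := h
  have key : ∀ i, y i * z 0 + (X *ᵥ (fun j => z j.succ)) (F i) = 0 := by
    intro i
    have := congrFun hzero i
    simpa [mulVec, dotProduct, Fin.sum_univ_succ] using this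
  by_cases h0 : z 0 = 0
  · left
    refine ⟨fun j => z j.succ, ?_, fun i => by simpa [h0] using key i⟩
    intro h
    apply hz
    ext j
    refine Fin.cases h0 (fun j => congrFun h j) j
  · right
    refine ⟨(-(z 0)⁻¹) • (fun j => z j.succ), fun i => ?_⟩
    rw [mulVec_smul, Pi.smul_apply, smul_eq_mul]
    have := key i
    field_simp
    linarith

lemma sum_minors_mulVec_eq_zero (X : Matrix (Fin n) (Fin m) ℝ) (F : Fin (m + 1) → Fin n)
    (u : Fin m → ℝ) :
    ∑ i : Fin (m + 1), (-1 : ℝ) ^ (i : ℕ) * (X *ᵥ u) (F i) *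
      (X.submatrix (F ∘ i.succAbove) id).det = 0 := by
  rw [← det_cons_submatrix X F (fun i => (X *ᵥ u) (F i)), ← exists_mulVec_eq_zero_iff]
  refine ⟨Fin.cons (-1) u, fun h => by simpa using congrFun h 0, ?_⟩
  ext i
  simp [mulVec, dotProduct, Fin.sum_univ_succ]

lemma exists_ne_zero_of_minors_eq_zero (X : Matrix (Fin n) (Fin m) ℝ) (F : Fin (m + 1) → Fin n)
    (h : ∀ i : Fin (m + 1), (X.submatrix (F ∘ i.succAbove) id).det = 0) :
    ∃ u ≠ 0, ∀ i, (X *ᵥ u) (F i) = 0 := by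
  by_contra hno
  have hsurj : Function.Surjective (X.submatrix F id).mulVecLin := by
    intro y
    obtain h1 | ⟨u, hu⟩ := exists_of_sum_minors_eq_zero X F y (by simp [h])
    · exact absurd h1 hno
    · exact ⟨u, funext hu⟩
  have := LinearMap.finrank_le_finrank_of_surjective hsurj
  simp at this

lemma det_submatrix_ne_zero_iff (X : Matrix (Fin n) (Fin m) ℝ) (f : Fin m → Fin n) :
    (X.submatrix f id).det ≠ 0 ↔ ∀ u, (∀ i, (X *ᵥ u) (f i) = 0) → u = 0 := by
  rw [Ne, ← exists_mulVec_eq_zero_iff]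
  push Not
  refine ⟨fun h u hu => ?_, fun h u hu h0 => hu (h u fun i => congrFun h0 i)⟩
  by_contra hne
  exact h u hne (funext hu)

lemma card_le_of_indicators_mem_range (X : Matrix (Fin n) (Fin m) ℝ) (K : Finset (Fin n))
    (h : ∀ κ ∈ K, ∃ y, ∀ s ∈ K, (X *ᵥ y) s = if s = κ then 1 else 0) : K.card ≤ m := by
  have h' : ∀ κ : K, ∃ y, ∀ s ∈ K, (X *ᵥ y) s = if s = κ then 1 else 0 := fun κ => h κ κ.2
  choose y hy using h'
  have hsurj : Function.Surjective (X.submatrix (Subtype.val : K → Fin n) id).mulVecLin := by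
    intro w
    refine ⟨∑ κ, w κ • y κ, ?_⟩
    ext s
    have : ((X.submatrix (Subtype.val : K → Fin n) id).mulVecLin (∑ κ, w κ • y κ)) s
        = ∑ κ, w κ * (X *ᵥ y κ) s := by
      rw [map_sum, Finset.sum_apply]
      refine Finset.sum_congr rfl fun κ _ => ?_
      rw [map_smul]
      rfl
    rw [this]
    simp only [fun κ => hy κ s s.2]
    simp
  have := LinearMap.finrank_le_finrank_of_surjective hsurj
  simpa using this

end Minors

/-! ### Sign consistency bounds the variation -/

section Forward

variable {n m : ℕ}

lemma card_filter_lt_orderEmbOfFin {k : ℕ} (S : Finset (Fin n)) (hS : S.card = k) (i : Fin k) :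
    (S.filter (· < S.orderEmbOfFin hS i)).card = i := by
  have : S.filter (· < S.orderEmbOfFin hS i) =
      (Finset.Iio i).map (S.orderEmbOfFin hS).toEmbedding := by
    ext x
    simp only [Finset.mem_filter, Finset.mem_map, Finset.mem_Iio]
    constructor
    · rintro ⟨hx, hlt⟩
      obtain ⟨j, rfl⟩ : x ∈ Set.range (S.orderEmbOfFin hS) := by simpa using hx
      exact ⟨j, by simpa using hlt, rfl⟩
    · rintro ⟨j, hj, rfl⟩
      exact ⟨by simp, by simpa using hj⟩
  rw [this, Finset.card_map, Fin.card_Iio]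

lemma exists_mulVec_eq_zero_on {X : Matrix (Fin n) (Fin m) ℝ} {τ : ℝ} (hτ : τ ≠ 0)
    (hsc : ∀ f : Fin m → Fin n, StrictMono f → 0 ≤ τ * (X.submatrix f id).det)
    {u : Fin m → ℝ} {S K : Finset (Fin n)} (hS : S.card = m + 1)
    (hind : ∀ κ ∈ K, ∃ y, ∀ s ∈ S, (X *ᵥ y) s = if s = κ then 1 else 0)
    (halt : ∀ s ∈ S, s ∉ K → 0 < (-1 : ℝ) ^ (S.filter (· < s)).card * (X *ᵥ u) s) :
    ∃ y ≠ 0, ∀ s ∈ S, (X *ᵥ y) s = 0 := by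
  set F := S.orderEmbOfFin hS with hF
  set D : Fin (m + 1) → ℝ := fun i => (X.submatrix (F ∘ i.succAbove) id).det with hD
  have hFS : ∀ i, F i ∈ S := fun i => by simp [hF]
  have hDK : ∀ i, F i ∈ K → D i = 0 := by
    intro i hi
    obtain ⟨y, hy⟩ := hind _ hi
    have := sum_minors_mulVec_eq_zero X F y
    simp only [fun j => hy _ (hFS j), EmbeddingLike.apply_eq_iff_eq] at this
    simpa using this
  have hterm : ∀ i : Fin (m + 1), 0 ≤ (-1 : ℝ) ^ (i : ℕ) * (X *ᵥ u) (F i) * (τ * D i) := by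
    intro i
    by_cases hi : F i ∈ K
    · simp [hDK i hi]
    · have h1 := halt _ (hFS i) hi
      rw [hF, card_filter_lt_orderEmbOfFin] at h1
      exact mul_nonneg h1.le (hsc _ (F.strictMono.comp (Fin.strictMono_succAbove i)))
  have hsum : ∑ i : Fin (m + 1), (-1 : ℝ) ^ (i : ℕ) * (X *ᵥ u) (F i) * (τ * D i) = 0 := by
    have := congrArg (τ * ·) (sum_minors_mulVec_eq_zero X F u)
    simp only [Finset.mul_sum, mul_zero] at this
    rw [← this]
    exact Finset.sum_congr rfl fun i _ => by ring
  have hzero : ∀ i, D i = 0 := by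
    intro i
    by_cases hi : F i ∈ K
    · exact hDK i hi
    · have h0 := (Finset.sum_eq_zero_iff_of_nonneg fun i _ => hterm i).1 hsum i (Finset.mem_univ i)
      have h1 := halt _ (hFS i) hi
      rw [hF, card_filter_lt_orderEmbOfFin] at h1
      simpa [h1.ne', hτ] using (mul_eq_zero.1 h0).resolve_left h1.ne'
  obtain ⟨y, hy, hy0⟩ := exists_ne_zero_of_minors_eq_zero X F hzero
  refine ⟨y, hy, fun s hs => ?_⟩
  obtain ⟨i, rfl⟩ : s ∈ Set.range F := by simpa [hF] using hs
  exact hy0 i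

/-- Exchanging `j` for `k` does not change the positions of elements that do not separate
`j` from `k`. -/
lemma card_filter_lt_exchange {S : Finset (Fin n)} {j k s : Fin n} (hj : j ∈ S) (hk : k ∉ S)
    (hs : k < s ↔ j < s) :
    ((insert k (S.erase j)).filter (· < s)).card = (S.filter (· < s)).card := by
  rw [Finset.filter_insert, Finset.filter_erase]
  split_ifs with h
  · have hmem : j ∈ S.filter (· < s) := by simp [hj, hs.1 h]
    rw [Finset.card_insert_of_notMem (by simp [hk]), Finset.card_erase_add_one hmem]
  · rw [Finset.erase_eq_of_notMem (by simp [← hs, h])]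

lemma not_alternating_off_coloops {X : Matrix (Fin n) (Fin m) ℝ}
    (hinj : ∀ y, X *ᵥ y = 0 → y = 0) {τ : ℝ} (hτ : τ ≠ 0)
    (hsc : ∀ f : Fin m → Fin n, StrictMono f → 0 ≤ τ * (X.submatrix f id).det)
    (u : Fin m → ℝ) (t : ℕ) :
    ∀ S K : Finset (Fin n), K ⊆ S → S.card = m + 1 → (S \ K).card = t →
      (∀ κ ∈ K, ∃ y, ∀ s ∈ S, (X *ᵥ y) s = if s = κ then 1 else 0) →
      ¬ ∀ s ∈ S, s ∉ K → 0 < (-1 : ℝ) ^ (S.filter (· < s)).card * (X *ᵥ u) s := by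
  induction t with
  | zero =>
    intro S K hKS hS ht hind _
    have : K.card ≤ m := card_le_of_indicators_mem_range X K fun κ hκ => by
      obtain ⟨y, hy⟩ := hind κ hκ
      exact ⟨y, fun s hs => hy s (hKS hs)⟩
    have := Finset.card_sdiff_add_card_eq_card hKS
    omega
  | succ t ih =>
    intro S K hKS hS ht hind halt
    obtain ⟨y, hy, hyS⟩ := exists_mulVec_eq_zero_on hτ hsc hS hind halt
    obtain ⟨k, hk⟩ : ∃ k, (X *ᵥ y) k ≠ 0 := by
      by_contra! h
      exact hy (hinj y (funext h))
    have hkS : k ∉ S := fun h => hk (hyS k h)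
    obtain ⟨j, hj, hmin⟩ := Finset.exists_min_image (S \ K)
      (fun s : Fin n => ((s : ℤ) - (k : ℤ)).natAbs) (Finset.card_pos.1 (by omega))
    obtain ⟨hjS, hjK⟩ := Finset.mem_sdiff.1 hj
    have hjk : j ≠ k := fun h => hkS (h ▸ hjS)
    refine ih (insert k (S.erase j)) (insert k K) ?_ ?_ ?_ ?_ ?_
    · refine Finset.insert_subset_insert _ fun x hx => Finset.mem_erase.2 ⟨?_, hKS hx⟩
      rintro rfl
      exact hjK hx
    · rw [Finset.card_insert_of_notMem (by simp [hkS]), Finset.card_erase_add_one hjS, hS]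
    · have : insert k (S.erase j) \ insert k K = (S \ K).erase j := by
        ext x
        simp only [Finset.mem_sdiff, Finset.mem_insert, Finset.mem_erase]
        by_cases hx : x = k
        · subst hx; simp [hkS]
        · simp [hx, and_assoc]
      rw [this, Finset.card_erase_of_mem hj, ht]
      rfl
    · intro κ hκ
      rcases Finset.mem_insert.1 hκ with rfl | hκ
      · refine ⟨((X *ᵥ y) κ)⁻¹ • y, fun s hs => ?_⟩
        rw [mulVec_smul, Pi.smul_apply, smul_eq_mul]
        rcases Finset.mem_insert.1 hs with rfl | hs
        · simp [hk]
        · have hsS := Finset.mem_of_mem_erase hs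
          have : s ≠ κ := fun h => hkS (h ▸ hsS)
          simp [hyS s hsS, this]
      · obtain ⟨z, hz⟩ := hind κ hκ
        refine ⟨z - ((X *ᵥ z) k / (X *ᵥ y) k) • y, fun s hs => ?_⟩
        rw [mulVec_sub, mulVec_smul, Pi.sub_apply, Pi.smul_apply, smul_eq_mul]
        rcases Finset.mem_insert.1 hs with rfl | hs
        · have : s ≠ κ := fun h => hkS (h ▸ hKS ‹κ ∈ K›)
          simp [hk, this]
        · have hsS := Finset.mem_of_mem_erase hs
          simp [hyS s hsS, hz s hsS]
    · intro s hs hsK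
      have hsk : s ≠ k := fun h => hsK (by simp [h])
      obtain ⟨hsj, hsS⟩ : s ≠ j ∧ s ∈ S := by simpa [hsk] using hs
      have hsK' : s ∉ K := fun h => hsK (by simp [h])
      have h1 := hmin s (Finset.mem_sdiff.2 ⟨hsS, hsK'⟩)
      rw [card_filter_lt_exchange hjS hkS (by
        simp only [Fin.lt_def, Ne, Fin.ext_iff] at *; omega)]
      exact halt s hsS hsK'

lemma not_alternating_of_minors {X : Matrix (Fin n) (Fin m) ℝ}
    (hinj : ∀ y, X *ᵥ y = 0 → y = 0) {τ : ℝ} (hτ : τ ≠ 0)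
    (hsc : ∀ f : Fin m → Fin n, StrictMono f → 0 ≤ τ * (X.submatrix f id).det)
    (u : Fin m → ℝ) {F : Fin (m + 1) → Fin n} (hF : StrictMono F) :
    ¬ ∀ i : Fin (m + 1), 0 < (-1 : ℝ) ^ (i : ℕ) * (X *ᵥ u) (F i) := by
  intro halt
  have hS : (Finset.univ.image F).card = m + 1 := by
    rw [Finset.card_image_of_injective _ hF.injective]; simp
  refine not_alternating_off_coloops hinj hτ hsc u _ (Finset.univ.image F) ∅ (by simp) hS rfl
    (by simp) ?_
  have hemb : F = (Finset.univ.image F).orderEmbOfFin hS :=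
    Finset.orderEmbOfFin_unique hS (by simp) hF
  intro s hs _
  obtain ⟨i, -, rfl⟩ := Finset.mem_image.1 hs
  have h := card_filter_lt_orderEmbOfFin _ hS i
  rw [← hemb] at h
  rw [h]
  exact halt i

end Forward

/-! ### Bounded variation forces sign consistency -/

section Backward

variable {n m : ℕ}

lemma exists_pos_sum_mul_eq_zero {ι : Type*} [Fintype ι] (D : ι → ℝ) {a b : ι}
    (ha : 0 < D a) (hb : D b < 0) : ∃ w : ι → ℝ, (∀ i, 0 < w i) ∧ ∑ i, w i * D i = 0 := by
  classical
  have key : ∀ (c : ι), D c ≠ 0 → 0 ≤ -(∑ i, D i) / D c →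
      ∃ w : ι → ℝ, (∀ i, 0 < w i) ∧ ∑ i, w i * D i = 0 := by
    intro c hc hnn
    refine ⟨fun i => 1 + if i = c then -(∑ i, D i) / D c else 0, fun i => ?_, ?_⟩
    · dsimp only
      split_ifs <;> linarith
    · simp only [add_mul, one_mul, Finset.sum_add_distrib, ite_mul, zero_mul,
        Finset.sum_ite_eq', Finset.mem_univ, if_true]
      field_simp
      ring
  rcases le_total 0 (∑ i, D i) with h | h
  · exact key b hb.ne (div_nonneg_of_nonpos (by linarith) hb.le)
  · exact key a ha.ne' (div_nonneg (by linarith) ha.le)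

lemma exists_alternating_of_minors {X : Matrix (Fin n) (Fin m) ℝ} {F : Fin (m + 1) → Fin n}
    {a b : Fin (m + 1)} (ha : 0 < (X.submatrix (F ∘ a.succAbove) id).det)
    (hb : (X.submatrix (F ∘ b.succAbove) id).det < 0) :
    ∃ u, ∀ i : Fin (m + 1), 0 < (-1 : ℝ) ^ (i : ℕ) * (X *ᵥ u) (F i) := by
  have hsq : ∀ i : ℕ, (-1 : ℝ) ^ i * (-1) ^ i = 1 := fun i => by rw [← mul_pow]; simp
  obtain ⟨w, hw, hsum⟩ := exists_pos_sum_mul_eq_zero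
    (fun i : Fin (m + 1) => (X.submatrix (F ∘ i.succAbove) id).det) ha hb
  obtain ⟨u, hu, hu0⟩ | ⟨u, hu⟩ := exists_of_sum_minors_eq_zero X F
    (fun i => (-1) ^ (i : ℕ) * w i) (by simpa only [← mul_assoc, hsq, one_mul] using hsum)
  · exact absurd ((det_submatrix_ne_zero_iff X _).1 ha.ne' u fun i => hu0 _) hu
  · exact ⟨u, fun i => by rw [hu, ← mul_assoc, hsq, one_mul]; exact hw i⟩

lemma exists_eq_comp_succAbove {S : Finset (Fin n)} (hS : S.card = m + 1) {f : Fin m → Fin n}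
    (hf : StrictMono f) (hfS : ∀ x, f x ∈ S) {p : Fin n} (hp : p ∈ S) (hfp : ∀ x, f x ≠ p) :
    ∃ a : Fin (m + 1), f = S.orderEmbOfFin hS ∘ a.succAbove := by
  obtain ⟨a, rfl⟩ : p ∈ Set.range (S.orderEmbOfFin hS) := by simpa using hp
  refine ⟨a, ?_⟩
  have hcard : (S.erase (S.orderEmbOfFin hS a)).card = m := by
    rw [Finset.card_erase_of_mem hp, hS]; rfl
  rw [Finset.orderEmbOfFin_unique hcard (f := f)
      (fun x => Finset.mem_erase.2 ⟨hfp x, hfS x⟩) hf,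
    Finset.orderEmbOfFin_unique hcard (f := S.orderEmbOfFin hS ∘ a.succAbove)
      (fun x => Finset.mem_erase.2 ⟨by simp [Fin.succAbove_ne], by simp⟩)
      ((S.orderEmbOfFin hS).strictMono.comp (Fin.strictMono_succAbove a))]

/-- Basis exchange for the rows of `X`. -/
lemma exists_exchange {X : Matrix (Fin n) (Fin m) ℝ} {f g : Fin m → Fin n}
    (hf : StrictMono f) (hdf : (X.submatrix f id).det ≠ 0) (hdg : (X.submatrix g id).det ≠ 0)
    {i : Fin m} (hi : f i ∉ Finset.univ.image g) :
    ∃ l, ∃ f' : Fin m → Fin n, StrictMono f' ∧ g l ∉ Finset.univ.image f ∧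
      Finset.univ.image f' = insert (g l) ((Finset.univ.image f).erase (f i)) ∧
      (X.submatrix f' id).det ≠ 0 := by
  obtain ⟨u, hu⟩ : ∃ u, (X.submatrix f id) *ᵥ u = Pi.single i 1 :=
    ⟨(X.submatrix f id)⁻¹ *ᵥ Pi.single i 1, by
      rw [mulVec_mulVec, mul_nonsing_inv _ (isUnit_iff_ne_zero.2 hdf), one_mulVec]⟩
  have hu' : ∀ x, (X *ᵥ u) (f x) = (Pi.single i 1 : Fin m → ℝ) x := fun x => congrFun hu x
  have hu0 : u ≠ 0 := by
    rintro rfl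
    simpa using hu' i
  obtain ⟨l, hl⟩ : ∃ l, (X *ᵥ u) (g l) ≠ 0 := by
    by_contra! h
    exact hu0 ((det_submatrix_ne_zero_iff X g).1 hdg u h)
  have hlf : g l ∉ Finset.univ.image f := by
    intro h
    obtain ⟨x, -, hx⟩ := Finset.mem_image.1 h
    by_cases hxi : x = i
    · subst hxi
      exact hi (by simp [hx])
    · exact hl (by rw [← hx, hu']; simp [hxi])
  have hcard : (insert (g l) ((Finset.univ.image f).erase (f i))).card = m := by
    rw [Finset.card_insert_of_notMem (fun h => hlf (Finset.mem_of_mem_erase h)),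
      Finset.card_erase_add_one (by simp), Finset.card_image_of_injective _ hf.injective]
    simp
  have himg : Finset.univ.image (Finset.orderEmbOfFin _ hcard) =
      insert (g l) ((Finset.univ.image f).erase (f i)) := by
    simp
  refine ⟨l, Finset.orderEmbOfFin _ hcard, (Finset.orderEmbOfFin _ hcard).strictMono, hlf,
    himg, ?_⟩
  rw [det_submatrix_ne_zero_iff]
  intro y hy
  have hy' : ∀ s ∈ insert (g l) ((Finset.univ.image f).erase (f i)), (X *ᵥ y) s = 0 := by
    intro s hs
    rw [← himg] at hs
    obtain ⟨x, -, rfl⟩ := Finset.mem_image.1 hs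
    exact hy x
  have hz : y - (X *ᵥ y) (f i) • u = 0 := by
    refine (det_submatrix_ne_zero_iff X f).1 hdf _ fun x => ?_
    rw [mulVec_sub, mulVec_smul, Pi.sub_apply, Pi.smul_apply, smul_eq_mul, hu']
    by_cases hxi : x = i
    · subst hxi; simp
    · rw [hy' (f x) (by simp [hf.injective.eq_iff, hxi])]
      simp [hxi]
  have h1 : (X *ᵥ y) (g l) = (X *ᵥ y) (f i) * (X *ᵥ u) (g l) := by
    conv_lhs => rw [sub_eq_zero.1 hz]
    rw [mulVec_smul, Pi.smul_apply, smul_eq_mul]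
  rw [hy' (g l) (by simp)] at h1
  have h2 : (X *ᵥ y) (f i) = 0 := (mul_eq_zero.1 h1.symm).resolve_right hl
  simpa [h2] using hz

lemma exists_alternating_of_opposite_minors {X : Matrix (Fin n) (Fin m) ℝ} (t : ℕ) :
    ∀ f g : Fin m → Fin n, StrictMono f → StrictMono g →
      (Finset.univ.image f \ Finset.univ.image g).card = t →
      0 < (X.submatrix f id).det → (X.submatrix g id).det < 0 →
      ∃ F : Fin (m + 1) → Fin n, StrictMono F ∧
        ∃ u, ∀ i : Fin (m + 1), 0 < (-1 : ℝ) ^ (i : ℕ) * (X *ᵥ u) (F i) := by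
  induction t with
  | zero =>
    intro f g hf hg ht hdf hdg
    have hcf : (Finset.univ.image f).card = m := by
      rw [Finset.card_image_of_injective _ hf.injective]; simp
    have hcg : (Finset.univ.image g).card = m := by
      rw [Finset.card_image_of_injective _ hg.injective]; simp
    have hsub : ∀ x, f x ∈ Finset.univ.image g := fun x =>
      (Finset.sdiff_eq_empty_iff_subset.1 (Finset.card_eq_zero.1 ht)) (by simp)
    have : f = g := (Finset.orderEmbOfFin_unique hcg hsub hf).trans
      (Finset.orderEmbOfFin_unique hcg (by simp) hg).symm
    rw [this] at hdf
    exact absurd hdf hdg.not_gt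
  | succ t ih =>
    intro f g hf hg ht hdf hdg
    obtain ⟨p, hp⟩ := Finset.card_pos.1 (show 0 < _ by rw [ht]; omega)
    obtain ⟨hpf, hpg⟩ := Finset.mem_sdiff.1 hp
    obtain ⟨i, -, rfl⟩ := Finset.mem_image.1 hpf
    obtain ⟨l, f', hf', hlf, himg, hdf'⟩ := exists_exchange hf hdf.ne' hdg.ne hpg
    rcases hdf'.lt_or_gt with hneg | hpos
    · have hS : (insert (g l) (Finset.univ.image f)).card = m + 1 := by
        rw [Finset.card_insert_of_notMem hlf, Finset.card_image_of_injective _ hf.injective]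
        simp
      have hf'mem : ∀ x, f' x ∈ insert (g l) ((Finset.univ.image f).erase (f i)) := fun x => by
        rw [← himg]; simp
      obtain ⟨a, ha⟩ := exists_eq_comp_succAbove hS hf (fun x => by simp) (p := g l)
        (by simp) (fun x h => hlf (by simp [← h]))
      obtain ⟨b, hb⟩ := exists_eq_comp_succAbove hS hf'
        (fun x => Finset.insert_subset_insert _ (Finset.erase_subset _ _) (hf'mem x))
        (p := f i) (by simp) (fun x h => by
          have h1 := hf'mem x
          rw [h, Finset.mem_insert] at h1
          rcases h1 with h1 | h1
          · exact hlf (by simp [← h1])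
          · simp at h1)
      refine ⟨_, (Finset.orderEmbOfFin _ hS).strictMono,
        exists_alternating_of_minors (a := a) (b := b) ?_ ?_⟩
      · rwa [← ha]
      · rwa [← hb]
    · refine ih f' g hf' hg ?_ hpos hdg
      have : Finset.univ.image f' \ Finset.univ.image g =
          (Finset.univ.image f \ Finset.univ.image g).erase (f i) := by
        rw [himg, Finset.insert_sdiff_of_mem _ (by simp), Finset.erase_sdiff_comm]
      rw [this, Finset.card_erase_of_mem hp, ht]
      rfl

end Backward

lemma mulVec_eq_zero_of_rank_eq {n m : ℕ} {X : Matrix (Fin n) (Fin m) ℝ} (hrk : X.rank = m)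
    {y : Fin m → ℝ} (hy : X *ᵥ y = 0) : y = 0 := by
  have h := LinearMap.finrank_range_add_finrank_ker X.mulVecLin
  have h1 : Module.finrank ℝ (LinearMap.range X.mulVecLin) = m := hrk
  rw [h1] at h
  have h2 : Module.finrank ℝ (LinearMap.ker X.mulVecLin) = 0 := by simpa using h
  have h3 : y ∈ LinearMap.ker X.mulVecLin := hy
  rwa [Submodule.finrank_eq_zero.1 h2, Submodule.mem_bot] at h3

/-- for `n > m` and `rank X = m`, `X` is `m`-sign consistent iff `X` is
`(m-1)`-variation bounding. -/
theorem stmt19 {n m : ℕ} (X : Matrix (Fin n) (Fin m) ℝ)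
    (hnm : m < n) (hrk : X.rank = m) :
    SC X m ↔ VB X (m - 1) := by
  have hid : ∀ g : Fin m → Fin m, StrictMono g → g = id := fun g hg =>
    (Finset.orderEmbOfFin_unique (Finset.card_fin m) (by simp) hg).trans
      (Finset.orderEmbOfFin_unique (Finset.card_fin m) (by simp) strictMono_id).symm
  constructor
  · intro hsc u hu _
    have hm : 0 < m := by
      rcases Nat.eq_zero_or_pos m with rfl | h
      · exact absurd (Subsingleton.elim u 0) hu
      · exact h
    by_contra! hlt
    obtain ⟨F, hF, σ, hσ⟩ := exists_alternating_of_le_variation (k := m) (v := X *ᵥ u) (by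
      have : ((m - 1 : ℕ) : ℤ) < variation (X *ᵥ u) := hlt
      omega)
    obtain ⟨τ, hτ, hsc'⟩ : ∃ τ : ℝ, τ ≠ 0 ∧
        ∀ f : Fin m → Fin n, StrictMono f → 0 ≤ τ * (X.submatrix f id).det := by
      rcases hsc with h | h
      · exact ⟨1, one_ne_zero, fun f hf => by simpa using h f id hf strictMono_id⟩
      · exact ⟨-1, by norm_num, fun f hf => by simpa using h f id hf strictMono_id⟩
    refine not_alternating_of_minors (fun y => mulVec_eq_zero_of_rank_eq hrk) hτ hsc' (σ • u) hF ?_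
    intro i
    rw [mulVec_smul, Pi.smul_apply, smul_eq_mul]
    exact hσ i
  · intro hvb
    by_contra hsc
    simp only [SC] at hsc
    push Not at hsc
    obtain ⟨⟨g, e, hg, he, hdg⟩, ⟨f, e', hf, he', hdf⟩⟩ := hsc
    rw [hid e he] at hdg
    rw [hid e' he'] at hdf
    have hm : 0 < m := by
      rcases Nat.eq_zero_or_pos m with rfl | h
      · simp at hdg
        linarith
      · exact h
    obtain ⟨F, hF, u, hu⟩ := exists_alternating_of_opposite_minors _ f g hf hg rfl hdf hdg
    have hu0 : u ≠ 0 := by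
      rintro rfl
      simpa using hu 0
    have h1 := hvb u hu0 (variation_le_pred u)
    have h2 := le_variation_of_alternating hF hu
    omega
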